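/- For all integers r ≥ 3 and n ≥ 0, there exists a twin-free K_r-saturated simple graph on n vertices if and only if none of the following holds: n = r; n = r+1; (r = 3 and n = 6); (r = 3 and n = 7). -/

import Mathlib

open SimpleGraph

/-- `G` is `K_r`-saturated: `G` contains no `r`-clique, but adding any missing edge
creates an `r`-clique. -/
def Ksat (r : ℕ) {V : Type*} (G : SimpleGraph V) : Prop :=
  G.CliqueFree r ∧ ∀ u v : V, u ≠ v → ¬ G.Adj u v →
    ¬ (G ⊔ fromEdgeSet {s(u, v)}).CliqueFree r

/-- `G` is twin-free: distinct vertices have distinct neighbourhoods. -/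
def TwinFree {V : Type*} (G : SimpleGraph V) : Prop :=
  ∀ u v : V, G.neighborSet u = G.neighborSet v → u = v

/-- Minimum degree of `G` is at least `t`. -/
def MinDegGe {V : Type*} (G : SimpleGraph V) (t : ℕ) : Prop :=
  ∀ v : V, t ≤ (G.neighborSet v).ncard

/-- Every pair of distinct twins has a common neighbour of degree exactly `t`. -/
def TwinCond {V : Type*} (G : SimpleGraph V) (t : ℕ) : Prop :=
  ∀ u v : V, u ≠ v → G.neighborSet u = G.neighborSet v →
    ∃ w : V, (G.neighborSet w).ncard = t ∧ G.Adj w u ∧ G.Adj w v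

/-- An `(r,t)`-system. -/
def IsRTSystem (r t : ℕ) {V : Type*} [DecidableEq V] (H : SimpleGraph V)
    (F : Finset (Finset V)) : Prop :=
  H.CliqueFree r ∧
  (∀ S ∈ F, S.card = t ∧
    (H.induce (S : Set V)).CliqueFree (r - 1) ∧
    ∀ v : V, v ∉ S → ¬ (H.induce ((insert v S : Finset V) : Set V)).CliqueFree (r - 1)) ∧
  (∀ S ∈ F, ∀ T ∈ F, S ≠ T → ¬ (H.induce ((S ∩ T : Finset V) : Set V)).CliqueFree (r - 2))

/-- A maximal `(r,t)`-system. -/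
def IsMaxRTSystem (r t : ℕ) {V : Type*} [DecidableEq V] (H : SimpleGraph V)
    (F : Finset (Finset V)) : Prop :=
  IsRTSystem r t H F ∧
  ∀ u v : V, u ≠ v → ¬ H.Adj u v →
    ¬ (H ⊔ fromEdgeSet {s(u, v)}).CliqueFree r ∨
    ∃ S ∈ F, ¬ (((H ⊔ fromEdgeSet {s(u, v)}).induce (S : Set V)).CliqueFree (r - 1))

/-- A `(3,t)`-system. -/
def Is3TSystem (t : ℕ) {V : Type*} [DecidableEq V] (H : SimpleGraph V)
    (F : Finset (Finset V)) : Prop :=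
  H.CliqueFree 3 ∧
  (∀ S ∈ F, S.card = t ∧
    (∀ u ∈ S, ∀ v ∈ S, ¬ H.Adj u v) ∧
    (∀ v : V, v ∉ S → ∃ u ∈ S, H.Adj v u)) ∧
  (∀ S ∈ F, ∀ T ∈ F, S ≠ T → (S ∩ T).Nonempty)

/-- A maximal `(3,t)`-system. -/
def IsMax3TSystem (t : ℕ) {V : Type*} [DecidableEq V] (H : SimpleGraph V)
    (F : Finset (Finset V)) : Prop :=
  Is3TSystem t H F ∧
  ∀ u v : V, u ≠ v → ¬ H.Adj u v →
    ¬ (H ⊔ fromEdgeSet {s(u, v)}).CliqueFree 3 ∨ ∃ S ∈ F, u ∈ S ∧ v ∈ S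

noncomputable def s3 (t m : ℕ) : ℕ :=
  sSup {a : ℕ | ∃ (H : SimpleGraph (Fin m)) (F : Finset (Finset (Fin m))),
    Is3TSystem t H F ∧ F.card = a}

noncomputable def ePrime (r t s : ℕ) : ℕ :=
  sInf {e : ℕ | ∃ (m : ℕ) (H : SimpleGraph (Fin m)) (F : Finset (Finset (Fin m))),
    IsMaxRTSystem r t H F ∧ F.card = s ∧ H.edgeSet.ncard = e}

noncomputable def e3min (t s : ℕ) : ℕ :=
  sInf {e : ℕ | ∃ (m : ℕ) (H : SimpleGraph (Fin m)) (F : Finset (Finset (Fin m))),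
    Is3TSystem t H F ∧ F.card = s ∧ H.edgeSet.ncard = e}

section

open Finset

section Characterization

variable {V W : Type*} {G : SimpleGraph V} {H : SimpleGraph W} {k : ℕ}

/-- A graph is `K_{k+2}`-saturated iff it has no `(k+2)`-clique and every two distinct
non-adjacent vertices have a `k`-clique in their common neighbourhood. -/
lemma ksat_add_two_iff : Ksat (k + 2) G ↔ G.CliqueFree (k + 2) ∧
    ∀ u v, u ≠ v → ¬ G.Adj u v → ∃ T, G.IsNClique k T ∧ ∀ x ∈ T, G.Adj u x ∧ G.Adj v x := by
  classical
  refine and_congr_right fun hfree ↦ forall₂_congr fun u v ↦ forall₂_congr fun huv hadj ↦ ?_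
  constructor
  · intro h
    obtain ⟨S, hS⟩ := not_forall_not.1 h
    change (G ⊔ edge u v).IsNClique (k + 2) S at hS
    have hu : u ∈ S := hfree.mem_of_sup_edge_isNClique hS
    have hv : v ∈ S := hfree.mem_of_sup_edge_isNClique (edge_comm .. ▸ hS)
    have hcl : ∀ x ∈ S, ∀ y ∈ S, x ≠ y → (x ≠ u ∨ y ≠ v) → (x ≠ v ∨ y ≠ u) → G.Adj x y := by
      intro x hx y hy hxy h1 h2
      have := hS.1 hx hy hxy
      simp only [sup_adj, edge_adj] at this
      grind
    refine ⟨(S.erase u).erase v, ⟨?_, ?_⟩, ?_⟩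
    · intro x hx y hy hxy
      simp only [coe_erase, Set.mem_sdiff, Set.mem_singleton_iff, mem_coe] at hx hy
      exact hcl x hx.1.1 y hy.1.1 hxy (.inl hx.1.2) (.inl hx.2)
    · rw [card_erase_of_mem (by simp [hv, huv.symm]), card_erase_of_mem hu, hS.2]
      rfl
    · intro x hx
      simp only [mem_erase] at hx
      exact ⟨hcl u hu x hx.2.2 (Ne.symm hx.2.1) (.inr hx.1) (.inl huv),
        hcl v hv x hx.2.2 (Ne.symm hx.1) (.inl huv.symm) (.inr hx.2.1)⟩
  · rintro ⟨T, hT, hTadj⟩ h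
    have hT' : (G ⊔ edge u v).IsNClique k T := hT.mono le_sup_left
    refine h (insert u (insert v T))
      ((hT'.insert fun x hx ↦ .inl (hTadj x hx).2).insert fun x hx ↦ ?_)
    rcases mem_insert.1 hx with rfl | hx
    · exact .inr ((fromEdgeSet_adj _).2 ⟨rfl, huv⟩)
    · exact .inl (hTadj x hx).1

lemma Ksat.of_iso (e : G ≃g H) (h : Ksat (k + 2) G) : Ksat (k + 2) H := by
  rw [ksat_add_two_iff] at h ⊢
  refine ⟨h.1.comap e.symm.toEmbedding.isContained, fun u v huv hadj ↦ ?_⟩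
  obtain ⟨T, hT, hTadj⟩ := h.2 (e.symm u) (e.symm v) (by simpa using huv)
    (by simpa [e.symm.map_adj_iff] using hadj)
  refine ⟨T.map e.toEquiv.toEmbedding, ⟨?_, by simpa using hT.2⟩, ?_⟩
  · intro x hx y hy hxy
    simp only [coe_map, Set.mem_image, mem_coe] at hx hy
    obtain ⟨x, hx, rfl⟩ := hx
    obtain ⟨y, hy, rfl⟩ := hy
    exact e.map_adj_iff.2 (hT.1 hx hy fun h ↦ hxy (by rw [h]))
  · intro y hy
    obtain ⟨x, hx, rfl⟩ := Finset.mem_map.1 hy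
    have := hTadj x hx
    rw [← e.map_adj_iff, ← e.map_adj_iff (v := e.symm v)] at this
    simpa using this

lemma TwinFree.of_iso (e : G ≃g H) (h : TwinFree G) : TwinFree H := by
  intro u v huv
  refine e.symm.injective (h _ _ (Set.ext fun x ↦ ?_))
  have := Set.ext_iff.1 huv (e x)
  simp only [mem_neighborSet] at this ⊢
  rw [← e.map_adj_iff, ← e.map_adj_iff (v := e.symm v)]
  simpa using this

lemma exists_fin_of_card [Fintype V] {n : ℕ} (hn : Fintype.card V = n)
    (h : Ksat (k + 2) G) (ht : TwinFree G) :
    ∃ G' : SimpleGraph (Fin n), Ksat (k + 2) G' ∧ TwinFree G' := by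
  let e := (Iso.comap (Fintype.equivFinOfCardEq hn).symm G).symm
  exact ⟨_, h.of_iso e, ht.of_iso e⟩

lemma ksat_three_iff : Ksat 3 G ↔ (∀ a b c, G.Adj a b → G.Adj a c → ¬ G.Adj b c) ∧
    ∀ u v, u ≠ v → ¬ G.Adj u v → ∃ x, G.Adj u x ∧ G.Adj v x := by
  classical
  rw [show 3 = 1 + 2 from rfl, ksat_add_two_iff]
  refine and_congr ⟨fun h a b c hab hac hbc ↦
    h {a, b, c} (is3Clique_triple_iff.2 ⟨hab, hac, hbc⟩), fun h S hS ↦ ?_⟩ ?_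
  · obtain ⟨a, b, c, hab, hac, hbc, -⟩ := is3Clique_iff.1 hS
    exact h a b c hab hac hbc
  · simp [isNClique_one]

lemma ksat_four_of (hfree : ∀ a b, G.Adj a b → ∀ c, G.Adj a c → G.Adj b c →
      ∀ d, G.Adj a d → G.Adj b d → ¬ G.Adj c d)
    (hsat : ∀ u v, u ≠ v → ¬ G.Adj u v →
      ∃ x, G.Adj u x ∧ G.Adj v x ∧ ∃ y, G.Adj u y ∧ G.Adj v y ∧ G.Adj x y) :
    Ksat 4 G := by
  classical
  refine ksat_add_two_iff (k := 2).2 ⟨fun S hS ↦ ?_, fun u v huv hadj ↦ ?_⟩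
  · obtain ⟨a, ha⟩ : S.Nonempty := card_pos.1 (by rw [hS.2]; norm_num)
    have h3 : G.IsNClique 3 (S.erase a) :=
      ⟨hS.1.subset (by simp), by rw [card_erase_of_mem ha, hS.2]⟩
    obtain ⟨b, c, d, hbc, hbd, hcd, hs⟩ := is3Clique_iff.1 h3
    have key : ∀ x ∈ S.erase a, G.Adj a x := fun x hx ↦
      hS.1 ha (mem_of_mem_erase hx) (ne_of_mem_erase hx).symm
    simp only [hs, mem_insert, mem_singleton, forall_eq_or_imp, forall_eq] at key
    exact hfree a b key.1 c key.2.1 hbc d key.2.2 hbd hcd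
  · obtain ⟨x, hux, hvx, y, huy, hvy, hxy⟩ := hsat u v huv hadj
    refine ⟨{x, y}, ⟨by simpa using fun _ ↦ hxy, card_pair hxy.ne⟩, by simp [*]⟩

lemma twinFree_iff : TwinFree G ↔ ∀ u v, u ≠ v → ∃ w, ¬ (G.Adj u w ↔ G.Adj v w) := by
  simp only [TwinFree, Set.ext_iff, mem_neighborSet, ← not_forall]
  exact forall₂_congr fun _ _ ↦ not_imp_not.symm.trans Iff.rfl

end Characterization

section Cone

variable {V : Type*}

/-- The graph obtained from `G` by adding a vertex adjacent to all vertices of `G`. -/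
def coneGraph (G : SimpleGraph V) : SimpleGraph (Option V) where
  Adj
    | some u, some v => G.Adj u v
    | none, none => False
    | _, _ => True
  symm := ⟨by rintro (_ | u) (_ | v) <;> simp [G.adj_comm]⟩
  loopless := ⟨by rintro (_ | u) <;> simp⟩

variable (G : SimpleGraph V)

@[simp] lemma coneGraph_some_some (u v : V) :
    (coneGraph G).Adj (some u) (some v) ↔ G.Adj u v := Iff.rfl

@[simp] lemma coneGraph_none_some (v : V) : (coneGraph G).Adj none (some v) := trivial

@[simp] lemma coneGraph_some_none (v : V) : (coneGraph G).Adj (some v) none := trivial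

variable {G} {k : ℕ}

lemma Ksat.coneGraph (h : Ksat (k + 2) G) : Ksat (k + 1 + 2) (coneGraph G) := by
  classical
  rw [ksat_add_two_iff] at h ⊢
  refine ⟨fun S hS ↦ ?_, ?_⟩
  · have hcl : G.IsClique (eraseNone S : Set V) := fun x hx y hy hxy ↦
      hS.1 (x := some x) (y := some y) (by simpa using hx) (by simpa using hy) (by simpa using hxy)
    have hcard : k + 2 ≤ #(eraseNone S) := by
      have := pred_card_le_card_erase (s := S) (a := none)
      have := hS.2
      rw [card_eraseNone_eq_card_erase]
      lia
    obtain ⟨T, hTS, hT⟩ := exists_subset_card_eq hcard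
    exact h.1 T ⟨hcl.subset (by exact_mod_cast hTS), hT⟩
  · rintro (_ | u) (_ | v) huv hadj <;> simp at huv hadj
    obtain ⟨T, hT, hTadj⟩ := h.2 u v huv hadj
    refine ⟨insertNone T, ⟨?_, by simp [hT.2]⟩, ?_⟩
    · rintro (_ | x) hx (_ | y) hy hxy <;> simp at hx hy hxy ⊢
      exact hT.1 hx hy hxy
    · rintro (_ | x) hx <;> simp at hx ⊢
      exact hTadj x hx

lemma TwinFree.coneGraph (h : TwinFree G) : TwinFree (coneGraph G) := by
  rw [twinFree_iff] at h ⊢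
  rintro (_ | u) (_ | v) huv
  · exact absurd rfl huv
  · exact ⟨some v, by simp⟩
  · exact ⟨none, by simp [SimpleGraph.irrefl]⟩
  · obtain ⟨w, hw⟩ := h u v (by simpa using huv)
    exact ⟨some w, by simpa using hw⟩

end Cone

section Transversal

variable {k : ℕ}

/-- The perfect matching on `Fin k × Bool`, together with one new vertex for every member `S`
of `F`, adjacent to the transversal of the matching given by the indicator function of `S`. -/
def transversalGraph (F : Finset (Finset (Fin k))) : SimpleGraph (Fin k × Bool ⊕ F) where
  Adj
    | .inl p, .inl q => p.1 = q.1 ∧ p.2 ≠ q.2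
    | .inl p, .inr S => decide (p.1 ∈ S.1) = p.2
    | .inr S, .inl p => decide (p.1 ∈ S.1) = p.2
    | .inr _, .inr _ => False
  symm := ⟨by rintro (p | S) (q | T) <;> simp +contextual [eq_comm]⟩
  loopless := ⟨by rintro (p | S) <;> simp⟩

variable (F : Finset (Finset (Fin k)))

@[simp] lemma transversalGraph_inl_inl (p q : Fin k × Bool) :
    (transversalGraph F).Adj (.inl p) (.inl q) ↔ p.1 = q.1 ∧ p.2 ≠ q.2 := Iff.rfl

@[simp] lemma transversalGraph_inl_inr (p : Fin k × Bool) (S : F) :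
    (transversalGraph F).Adj (.inl p) (.inr S) ↔ decide (p.1 ∈ S.1) = p.2 := Iff.rfl

@[simp] lemma transversalGraph_inr_inl (p : Fin k × Bool) (S : F) :
    (transversalGraph F).Adj (.inr S) (.inl p) ↔ decide (p.1 ∈ S.1) = p.2 := Iff.rfl

@[simp] lemma transversalGraph_inr_inr (S T : F) :
    ¬ (transversalGraph F).Adj (.inr S) (.inr T) := id

variable {F}

lemma ksat_transversalGraph (hcompl : ∀ S ∈ F, Sᶜ ∉ F)
    (hsep : ∀ i j, i ≠ j → ∀ a b : Bool, ∃ S ∈ F, decide (i ∈ S) = a ∧ decide (j ∈ S) = b) :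
    Ksat 3 (transversalGraph F) := by
  refine ksat_three_iff.2 ⟨?_, ?_⟩
  · rintro (⟨i, _ | _⟩ | S) (⟨j, _ | _⟩ | T) (⟨l, c⟩ | U) <;> simp <;> grind
  · rintro (⟨i, a⟩ | S) (⟨j, b⟩ | T) huv hadj
    · have hij : i ≠ j := by
        rintro rfl
        simp_all
      obtain ⟨S, hS, hi, hj⟩ := hsep i j hij a b
      exact ⟨.inr ⟨S, hS⟩, by simpa using hi, by simpa using hj⟩
    · exact ⟨.inl (i, !a), by simp, by simpa [Bool.eq_not] using hadj⟩
    · exact ⟨.inl (j, !b), by simpa [Bool.eq_not] using hadj, by simp⟩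
    · by_contra! hno
      refine hcompl S.1 S.2 ?_
      convert T.2
      ext i
      have := hno (.inl (i, decide (i ∈ S.1)))
      simp at this
      simp only [mem_compl]
      grind

lemma twinFree_transversalGraph (hk : 2 ≤ k) : TwinFree (transversalGraph F) := by
  have : Nontrivial (Fin k) := Fin.nontrivial_iff_two_le.2 hk
  rw [twinFree_iff]
  rintro (⟨i, a⟩ | S) (⟨j, b⟩ | T) huv
  · exact ⟨.inl (i, !a), by simpa [eq_comm] using huv⟩
  · obtain ⟨j, hj⟩ := exists_ne i
    exact ⟨.inl (j, decide (j ∈ T.1)), by simp [hj.symm]⟩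
  · obtain ⟨i, hi⟩ := exists_ne j
    exact ⟨.inl (i, decide (i ∈ S.1)), by simp [hi.symm]⟩
  · have hST : S.1 ≠ T.1 := fun h ↦ huv (by rw [Subtype.ext h])
    obtain ⟨i, hi⟩ : ∃ i, ¬ (i ∈ S.1 ↔ i ∈ T.1) := by
      by_contra! h
      exact hST (Finset.ext h)
    refine ⟨.inl (i, decide (i ∈ S.1)), ?_⟩
    simp only [transversalGraph_inr_inl, true_iff, decide_eq_decide]
    tauto

lemma exists_separating_family {k s : ℕ} (hk : 4 ≤ k) (hs : k + 1 ≤ s) (hs' : s ≤ k + 3) :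
    ∃ F : Finset (Finset (Fin k)), #F = s ∧ (∀ S ∈ F, Sᶜ ∉ F) ∧
      ∀ i j, i ≠ j → ∀ a b : Bool, ∃ S ∈ F, decide (i ∈ S) = a ∧ decide (j ∈ S) = b := by
  obtain ⟨m, rfl⟩ := Nat.exists_eq_add_of_le' hk
  set E : Finset (Finset (Fin (m + 4))) := insert univ (univ.image singleton) with hE
  set U : Finset (Finset (Fin (m + 4))) := insert {0, 1} (insert {0, 2} E) with hU
  have h01 : #({0, 1} : Finset (Fin (m + 4))) = 2 := card_pair (by simp)
  have h02 : #({0, 2} : Finset (Fin (m + 4))) = 2 :=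
    card_pair (by simp [Fin.ext_iff, Nat.mod_eq_of_lt (show 2 < m + 4 by lia)])
  have hmemE : ∀ S ∈ E, #S = m + 4 ∨ #S = 1 := by
    intro S hS
    simp only [hE, mem_insert, mem_image, mem_univ, true_and] at hS
    rcases hS with rfl | ⟨i, rfl⟩ <;> simp
  have hcardE : #E = m + 4 + 1 := by
    rw [hE, card_insert_of_notMem, card_image_of_injective _ singleton_injective, card_univ,
      Fintype.card_fin]
    intro h
    obtain ⟨i, -, hi⟩ := mem_image.1 h
    simpa using congrArg card hi
  have hcardU : #U = m + 4 + 3 := by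
    have h2 : ({0, 2} : Finset (Fin (m + 4))) ∉ E := fun h ↦ by
      have := hmemE _ h
      lia
    have h1 : ({0, 1} : Finset (Fin (m + 4))) ∉ insert {0, 2} E := fun h ↦ by
      rcases mem_insert.1 h with h | h
      · have : (1 : Fin (m + 4)) ∈ ({0, 2} : Finset (Fin (m + 4))) := h ▸ by simp
        simp [Fin.ext_iff, Nat.mod_eq_of_lt (show 2 < m + 4 by lia)] at this
      · have := hmemE _ h
        lia
    rw [hU, card_insert_of_notMem h1, card_insert_of_notMem h2, hcardE]
  obtain ⟨F, hEF, hFU, hF⟩ := exists_subsuperset_card_eq (s := E) (t := U) (n := s)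
    ((subset_insert _ _).trans (subset_insert _ _)) (by lia) (by lia)
  have hmem : ∀ S ∈ F, #S = m + 4 ∨ #S = 1 ∨ #S = 2 ∧ 0 ∈ S := by
    intro S hS
    rcases mem_insert.1 (hFU hS) with rfl | h
    · simp [h01]
    rcases mem_insert.1 h with rfl | h
    · simp [h02]
    have := hmemE S h
    tauto
  have hsingle : ∀ i, {i} ∈ F := fun i ↦ hEF (by simp [hE])
  refine ⟨F, hF, fun S hS hSc ↦ ?_, fun i j hij a b ↦ ?_⟩
  · have hadd := card_add_card_compl S
    have h1 := hmem S hS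
    have h2 := hmem _ hSc
    rw [Fintype.card_fin] at hadd
    rw [mem_compl] at h2
    lia
  · cases a <;> cases b
    · have hne : (({i, j} : Finset (Fin (m + 4)))ᶜ).Nonempty := by
        rw [← card_pos, card_compl, card_pair hij, Fintype.card_fin]
        lia
      obtain ⟨l, hl⟩ := hne
      refine ⟨{l}, hsingle l, ?_⟩
      simp at hl
      simp [Ne.symm hl.1, Ne.symm hl.2]
    · exact ⟨{j}, hsingle j, by simp [hij]⟩
    · exact ⟨{i}, hsingle i, by simp [hij.symm]⟩
    · exact ⟨univ, hEF (by simp [hE]), by simp⟩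

lemma exists_twinFree_ksat_three_of_large {n : ℕ} (hn : 13 ≤ n) :
    ∃ G : SimpleGraph (Fin n), Ksat 3 G ∧ TwinFree G := by
  obtain ⟨F, hF, hcompl, hsep⟩ := exists_separating_family
    (k := (n - 1) / 3) (s := n - 2 * ((n - 1) / 3)) (by lia) (by lia) (by lia)
  refine exists_fin_of_card (k := 1) ?_ (ksat_transversalGraph hcompl hsep)
    (twinFree_transversalGraph (by lia))
  simp [hF]
  lia

end Transversal

section Small

/-- The graph whose edges are the pairs occurring in the list `L`. -/
def edgeListGraph {n : ℕ} (L : List (Fin n × Fin n)) : SimpleGraph (Fin n) :=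
  fromRel fun u v ↦ (u, v) ∈ L

instance {n : ℕ} (L : List (Fin n × Fin n)) : DecidableRel (edgeListGraph L).Adj :=
  fun _ _ ↦ inferInstanceAs (Decidable (_ ∧ _))

lemma exists_twinFree_ksat_three_of_decide {n : ℕ} (G : SimpleGraph (Fin n))
    (hfree : ∀ a b, G.Adj a b → ∀ c, G.Adj a c → ¬ G.Adj b c)
    (hsat : ∀ u v, u ≠ v → ¬ G.Adj u v → ∃ x, G.Adj u x ∧ G.Adj v x)
    (htwin : ∀ u v, u ≠ v → ∃ w, ¬ (G.Adj u w ↔ G.Adj v w)) :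
    ∃ G : SimpleGraph (Fin n), Ksat 3 G ∧ TwinFree G :=
  ⟨G, ksat_three_iff.2 ⟨fun a b c hab ↦ hfree a b hab c, hsat⟩, twinFree_iff.2 htwin⟩

lemma exists_twinFree_ksat_three_of_small {n : ℕ} (hn : n = 5 ∨ 8 ≤ n ∧ n ≤ 12) :
    ∃ G : SimpleGraph (Fin n), Ksat 3 G ∧ TwinFree G := by
  have hn' : n = 5 ∨ n = 8 ∨ n = 9 ∨ n = 10 ∨ n = 11 ∨ n = 12 := by lia
  rcases hn' with rfl | rfl | rfl | rfl | rfl | rfl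
  · apply exists_twinFree_ksat_three_of_decide
      (circulantGraph (({1} : Finset (Fin 5)) : Set (Fin 5))) <;> decide +kernel
  · apply exists_twinFree_ksat_three_of_decide
      (circulantGraph (({1, 4} : Finset (Fin 8)) : Set (Fin 8))) <;> decide +kernel
  · apply exists_twinFree_ksat_three_of_decide
      (edgeListGraph [(1, 0), (3, 1), (4, 0), (5, 1), (5, 2), (6, 2), (6, 3), (6, 4), (7, 0),
        (7, 2), (7, 3), (8, 3), (8, 4), (8, 5)]) <;> decide +kernel
  · apply exists_twinFree_ksat_three_of_decide
      (edgeListGraph [(0, 1), (1, 2), (2, 3), (3, 4), (4, 0), (0, 5), (1, 6), (2, 7), (3, 8),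
        (4, 9), (5, 7), (7, 9), (9, 6), (6, 8), (8, 5)]) <;> decide +kernel
  · apply exists_twinFree_ksat_three_of_decide
      (circulantGraph (({1, 4} : Finset (Fin 11)) : Set (Fin 11))) <;> decide +kernel
  · apply exists_twinFree_ksat_three_of_decide
      (circulantGraph (({2, 3} : Finset (Fin 12)) : Set (Fin 12))) <;> decide +kernel

lemma exists_twinFree_ksat_four_of_small {n : ℕ} (hn : n = 7 ∨ n = 8) :
    ∃ G : SimpleGraph (Fin n), Ksat 4 G ∧ TwinFree G := by
  rcases hn with rfl | rfl
  · refine ⟨edgeListGraph [(0, 2), (1, 3), (2, 4), (3, 5), (4, 6), (5, 0), 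
      (6, 1), (0, 3), (1, 4), (2, 5), (3, 6), (4, 0), (5, 1), (6, 2)], ksat_four_of ?_ ?_,
      twinFree_iff.2 ?_⟩ <;> decide +kernel
  · refine ⟨edgeListGraph [(1, 0), (2, 0), (2, 1), (3, 0), (3, 2), (4, 1), (4, 2), (5, 1), (5, 2),
      (5, 3), (6, 0), (6, 3), (6, 4), (7, 1), (7, 3), (7, 4), (7, 5), (7, 6)], ksat_four_of ?_ ?_,
      twinFree_iff.2 ?_⟩ <;> decide +kernel

end Small

lemma exists_twinFree_ksat_of_lt {r n : ℕ} (hn : n < r) :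
    ∃ G : SimpleGraph (Fin n), Ksat r G ∧ TwinFree G := by
  refine ⟨⊤, ⟨cliqueFree_of_card_lt (by simpa), fun u v huv hadj ↦ absurd huv hadj⟩,
    twinFree_iff.2 fun u v huv ↦ ⟨v, by simpa using huv⟩⟩

lemma exists_twinFree_ksat_of_ge {r : ℕ} (hr : 3 ≤ r) : ∀ {n : ℕ}, r + 2 ≤ n →
    ¬ (r = 3 ∧ n = 6) → ¬ (r = 3 ∧ n = 7) →
    ∃ G : SimpleGraph (Fin n), Ksat r G ∧ TwinFree G := by
  induction r, hr using Nat.le_induction with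
  | base =>
    intro n hn h6 h7
    rcases lt_or_ge n 13 with h | h
    · exact exists_twinFree_ksat_three_of_small (by lia)
    · exact exists_twinFree_ksat_three_of_large h
  | succ r hr ih =>
    intro n hn _ _
    by_cases h : r = 3 ∧ (n = 7 ∨ n = 8)
    · obtain ⟨rfl, h⟩ := h
      exact exists_twinFree_ksat_four_of_small h
    · obtain ⟨G, hG, ht⟩ := ih (n := n - 1) (by lia) (by lia) (by lia)
      obtain ⟨k, rfl⟩ := Nat.exists_eq_add_of_le' (show 2 ≤ r by lia)
      exact exists_fin_of_card (k := k + 1) (by simp; lia) hG.coneGraph ht.coneGraph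

section FiveCycle

variable {V : Type*} {G : SimpleGraph V}

lemma exists_five_cycle (hfree : ∀ a b c, G.Adj a b → G.Adj a c → ¬ G.Adj b c)
    (hsat : ∀ u v, u ≠ v → ¬ G.Adj u v → ∃ x, G.Adj u x ∧ G.Adj v x) (ht : TwinFree G)
    (hne : ∃ u v, u ≠ v ∧ ¬ G.Adj u v) :
    ∃ a b c d e, [a, b, c, d, e].Nodup ∧
      G.Adj a b ∧ G.Adj b c ∧ G.Adj c d ∧ G.Adj d e ∧ G.Adj e a := by
  obtain ⟨u, v, x, huv, hadj, hux, hvx⟩ :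
      ∃ u v x, u ≠ v ∧ ¬ G.Adj u v ∧ G.Adj u x ∧ ¬ G.Adj v x := by
    obtain ⟨u, v, huv, hadj⟩ := hne
    obtain ⟨x, hx⟩ := twinFree_iff.1 ht u v huv
    by_cases hux : G.Adj u x
    · exact ⟨u, v, x, huv, hadj, hux, by tauto⟩
    · exact ⟨v, u, x, huv.symm, by rwa [G.adj_comm], by tauto, hux⟩
  obtain ⟨y, hvy, hxy⟩ := hsat v x (fun h ↦ hadj (h ▸ hux)) hvx
  obtain ⟨z, huz, hvz⟩ := hsat u v huv hadj
  have hsymm : ∀ a b, G.Adj a b → G.Adj b a := fun _ _ h ↦ h.symm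
  have hirr : ∀ a, ¬ G.Adj a a := fun _ ↦ G.irrefl
  exact ⟨u, x, y, v, z, by simp; grind, hux, hxy, hvy.symm, hvz, huz.symm⟩

variable {a b c d e x y : V} (hfree : ∀ a b c, G.Adj a b → G.Adj a c → ¬ G.Adj b c)
  (hsat : ∀ u v, u ≠ v → ¬ G.Adj u v → ∃ x, G.Adj u x ∧ G.Adj v x)
  (hab : G.Adj a b) (hbc : G.Adj b c) (hcd : G.Adj c d) (hea : G.Adj e a)
  (hx : x ∉ [a, b, c, d, e]) (hy : y ∉ [a, b, c, d, e])
  (hcover : ∀ z, z ∈ [a, b, c, d, e] ∨ z = x ∨ z = y)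

include hfree hsat hab hbc hcd hea hx hy hcover

lemma five_cycle_not_adj_pair (ht : TwinFree G) (hxa : G.Adj x a) : ¬ G.Adj x c := by
  intro hxc
  simp only [List.mem_cons, List.not_mem_nil, or_false, not_or] at hx hy hcover
  have hsymm : ∀ a b, G.Adj a b → G.Adj b a := fun _ _ h ↦ h.symm
  have hirr : ∀ a, ¬ G.Adj a a := fun _ ↦ G.irrefl
  have hxy : G.Adj x y ↔ G.Adj b y := by
    constructor
    · intro h
      by_contra hby
      obtain ⟨z, hz, hz'⟩ := hsat b y (Ne.symm hy.2.1) hby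
      have := hcover z
      grind
    · intro h
      by_contra hxy
      obtain ⟨z, hz, hz'⟩ := hsat x y (by grind) hxy
      have := hcover z
      grind
  refine hx.2.1 (ht x b (Set.ext fun z ↦ ?_))
  simp only [mem_neighborSet]
  have := hcover z
  grind

lemma five_cycle_exists_adj (hde : G.Adj d e) :
    G.Adj x b ∨ G.Adj x c ∨ G.Adj x d ∨ G.Adj x e := by
  by_contra! hno
  simp only [List.mem_cons, List.not_mem_nil, or_false, not_or] at hx hy hcover
  have hsymm : ∀ a b, G.Adj a b → G.Adj b a := fun _ _ h ↦ h.symm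
  have hirr : ∀ a, ¬ G.Adj a a := fun _ ↦ G.irrefl
  have hadj : ∀ v, v ≠ x → ¬ G.Adj x v → ¬ G.Adj v a → G.Adj v y := by
    intro v hvx hxv hva
    obtain ⟨z, hz, hz'⟩ := hsat x v hvx.symm hxv
    have := hcover z
    clear hsat hfree hcover
    grind
  have hca : ¬ G.Adj c a := fun h ↦ hfree a b c hab h.symm hbc
  have hda : ¬ G.Adj d a := fun h ↦ hfree e d a hde.symm hea h
  exact hfree c d y hcd (hadj c (by tauto) hno.2.1 hca) (hadj d (by tauto) hno.2.2.1 hda)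

end FiveCycle

section Nonexistence

variable {V : Type*} [Fintype V] {G : SimpleGraph V} {k r : ℕ}

lemma exists_not_adj (hfree : G.CliqueFree r) (hr : r ≤ Fintype.card V) :
    ∃ u v, u ≠ v ∧ ¬ G.Adj u v := by
  by_contra! h
  exact hfree.mono hr univ ⟨fun u _ v _ huv ↦ h u v huv, card_univ⟩

lemma not_twinFree_of_card_eq (h : Ksat (k + 2) G) (hcard : Fintype.card V = k + 2) :
    ¬ TwinFree G := by
  classical
  rw [twinFree_iff]
  intro ht
  rw [ksat_add_two_iff] at h
  obtain ⟨u, v, huv, hadj⟩ := exists_not_adj h.1 hcard.ge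
  obtain ⟨T, hT, hTadj⟩ := h.2 u v huv hadj
  have huT : u ∉ T := fun hu ↦ (hTadj u hu).1.ne rfl
  have hvT : v ∉ T := fun hv ↦ (hTadj v hv).2.ne rfl
  have huniv : insert u (insert v T) = univ := by
    rw [← card_eq_iff_eq_univ, card_insert_of_notMem (by simp [huv, huT]),
      card_insert_of_notMem hvT, hT.2, hcard]
  obtain ⟨w, hw⟩ := ht u v huv
  have hmem : w ∈ insert u (insert v T) := huniv ▸ mem_univ w
  simp only [mem_insert] at hmem
  rcases hmem with rfl | rfl | hmem
  · simp [G.adj_comm v, hadj] at hw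
  · simp [hadj] at hw
  · simp [hTadj w hmem] at hw

lemma not_twinFree_of_card_eq_add_one (h : Ksat (k + 2) G) (hcard : Fintype.card V = k + 2 + 1) :
    ¬ TwinFree G := by
  classical
  rw [twinFree_iff]
  intro ht
  rw [ksat_add_two_iff] at h
  have hstar : ∀ u v, u ≠ v → ¬ G.Adj u v → ∃ w, ∀ x y, x ≠ y → ¬ G.Adj x y →
      (x = u ∧ y = v) ∨ (x = v ∧ y = u) ∨ (x = w ∨ y = w) ∧ w ≠ u ∧ w ≠ v := by
    intro u v huv hadj
    obtain ⟨T, hT, hTadj⟩ := h.2 u v huv hadj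
    have huT : u ∉ T := fun hu ↦ (hTadj u hu).1.ne rfl
    have hvT : v ∉ T := fun hv ↦ (hTadj v hv).2.ne rfl
    have hc : #(insert u (insert v T))ᶜ = 1 := by
      rw [card_compl, card_insert_of_notMem (by simp [huv, huT]),
        card_insert_of_notMem hvT, hT.2, hcard]
      lia
    obtain ⟨w, hw⟩ := card_eq_one.1 hc
    have hmem : ∀ x, (x ≠ u ∧ x ≠ v ∧ x ∉ T) ↔ x = w := fun x ↦ by
      simpa using Finset.ext_iff.1 hw x
    have hTT : ∀ x ∈ T, ∀ y ∈ T, x ≠ y → G.Adj x y := fun x hx y hy ↦ hT.1 hx hy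
    refine ⟨w, fun x y hxy hnadj ↦ ?_⟩
    have := G.adj_comm x y
    grind
  have main : ∀ u v, u ≠ v → ¬ G.Adj u v → ∀ x, G.Adj u x → G.Adj v x := by
    intro u v huv hadj x hux
    by_contra hvx
    have hxv : v ≠ x := by
      rintro rfl
      exact hadj hux
    obtain ⟨w, hw⟩ := hstar u v huv hadj
    obtain ⟨w', hw'⟩ := hstar v x hxv hvx
    have hcl : ∀ a b, a ≠ v → b ≠ v → a ≠ b → G.Adj a b := by
      intro a b ha hb hab
      by_contra hnadj
      have h1 := hw a b hab hnadj
      have h2 := hw' a b hab hnadj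
      have h3 := hw v x hxv hvx
      have h4 := hw' u v huv hadj
      have := hux.ne
      have := G.adj_comm a b
      grind
    refine h.1 {v}ᶜ ⟨fun a ha b hb hab ↦ hcl a b (by simpa using ha) (by simpa using hb) hab, ?_⟩
    rw [card_compl, card_singleton, hcard]
    lia
  obtain ⟨u, v, huv, hadj⟩ := exists_not_adj h.1 (by lia)
  obtain ⟨w, hw⟩ := ht u v huv
  exact hw ⟨main u v huv hadj w, main v u huv.symm (by rwa [G.adj_comm]) w⟩

lemma not_twinFree_of_ksat_three (h : Ksat 3 G)
    (hcard : Fintype.card V = 6 ∨ Fintype.card V = 7) : ¬ TwinFree G := by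
  classical
  intro ht
  obtain ⟨hfree, hsat⟩ := ksat_three_iff.1 h
  obtain ⟨a, b, c, d, e, hnd, hab, hbc, hcd, hde, hea⟩ :=
    exists_five_cycle hfree hsat ht (exists_not_adj h.1 (by lia))
  obtain ⟨x, y, hx, hy, hcover⟩ : ∃ x y, x ∉ [a, b, c, d, e] ∧ y ∉ [a, b, c, d, e] ∧
      ∀ z, z ∈ [a, b, c, d, e] ∨ z = x ∨ z = y := by
    have hC : #([a, b, c, d, e].toFinsetᶜ) = 1 ∨ #([a, b, c, d, e].toFinsetᶜ) = 2 := by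
      rw [card_compl, List.toFinset_card_of_nodup hnd]
      simp
      lia
    obtain ⟨x, y, hxy⟩ : ∃ x y, [a, b, c, d, e].toFinsetᶜ = {x, y} := by
      rcases hC with hC | hC
      · obtain ⟨x, hx⟩ := card_eq_one.1 hC
        exact ⟨x, x, by simpa using hx⟩
      · obtain ⟨x, y, -, hxy⟩ := card_eq_two.1 hC
        exact ⟨x, y, hxy⟩
    have key : ∀ z, z ∉ [a, b, c, d, e] ↔ z = x ∨ z = y := fun z ↦ by
      rw [← List.mem_toFinset, ← mem_compl, hxy, mem_insert, mem_singleton]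
    exact ⟨x, y, (key x).2 (.inl rfl), (key y).2 (.inr rfl), fun z ↦ by
      have := key z
      tauto⟩
  have hcycle : ∀ {p q r s t}, (∀ z, z ∈ [p, q, r, s, t] ↔ z ∈ [a, b, c, d, e]) →
      G.Adj p q → G.Adj q r → G.Adj r s → G.Adj s t → G.Adj t p →
      (G.Adj x p → ¬ G.Adj x r) ∧ (G.Adj x q ∨ G.Adj x r ∨ G.Adj x s ∨ G.Adj x t) := by
    intro p q r s t hmem h1 h2 h3 h4 h5
    simp only [← hmem] at hx hy hcover
    exact ⟨five_cycle_not_adj_pair hfree hsat h1 h2 h3 h5 hx hy hcover ht,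
      five_cycle_exists_adj hfree hsat h1 h2 h3 h5 hx hy hcover h4⟩
  have h1 := hcycle (fun _ ↦ Iff.rfl) hab hbc hcd hde hea
  have h2 := hcycle (fun _ ↦ List.mem_rotate (l := [a, b, c, d, e]) (n := 1)) hbc hcd hde hea hab
  have h3 := hcycle (fun _ ↦ List.mem_rotate (l := [a, b, c, d, e]) (n := 2)) hcd hde hea hab hbc
  have h4 := hcycle (fun _ ↦ List.mem_rotate (l := [a, b, c, d, e]) (n := 3)) hde hea hab hbc hcd
  have h5 := hcycle (fun _ ↦ List.mem_rotate (l := [a, b, c, d, e]) (n := 4)) hea hab hbc hcd hde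
  have t1 := fun h ↦ hfree a b x hab h
  have t2 := fun h ↦ hfree b c x hbc h
  have t3 := fun h ↦ hfree c d x hcd h
  have t4 := fun h ↦ hfree d e x hde h
  have t5 := fun h ↦ hfree e a x hea h
  simp only [G.adj_comm _ x] at t1 t2 t3 t4 t5
  clear hcycle hfree hsat hcover
  grind

end Nonexistence

end

/-- For all integers `r ≥ 3` and `n ≥ 0`, a twin-free `K_r`-saturated graph
on `n` vertices exists iff `n ≠ r`, `n ≠ r+1`, and not (`r = 3` and `n ∈ {6,7}`). -/
theorem stmt0 (r n : ℕ) (hr : 3 ≤ r) :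
    (∃ G : SimpleGraph (Fin n), Ksat r G ∧ TwinFree G) ↔
      ¬ (n = r ∨ n = r + 1 ∨ (r = 3 ∧ n = 6) ∨ (r = 3 ∧ n = 7)) := by
  constructor
  · rintro ⟨G, hG, ht⟩ hn
    obtain ⟨k, rfl⟩ := Nat.exists_eq_add_of_le' (show 2 ≤ r by lia)
    rcases hn with rfl | rfl | ⟨hk, rfl⟩ | ⟨hk, rfl⟩
    · exact not_twinFree_of_card_eq hG (by simp) ht
    · exact not_twinFree_of_card_eq_add_one hG (by simp) ht
    all_goals exact not_twinFree_of_ksat_three (hk ▸ hG) (by simp) ht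
  · intro hn
    rcases lt_or_ge n r with h | h
    · exact exists_twinFree_ksat_of_lt h
    · exact exists_twinFree_ksat_of_ge hr (by lia) (by tauto) (by tauto)
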